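/- The π√−1·(log p)⁻¹ term in the third shift vector may be omitted: the shifted Yang–Baxter identity R₁₂(x; φ+Φ̂(−κ)₃) R₂₃(x+y; φ+Φ̂(κ)₁) R₁₂(y; φ+Φ̂(−κ)₃) = R₂₃(y; φ+Φ̂(κ)₁) R₁₂(x+y; φ+Φ̂(−κ)₃) R₂₃(x; φ+Φ̂(κ)₁) holds for all admissible x, y ∈ ℂ and φ ∈ ℂ³ if and only if the identity R₁₂(x; φ+Ξ̂(−κ)₃) R₂₃(x+y; φ+Ξ̂(κ)₁) R₁₂(y; φ+Ξ̂(−κ)₃) = R₂₃(y; φ+Ξ̂(κ)₁) R₁₂(x+y; φ+Ξ̂(−κ)₃) R₂₃(x; φ+Ξ̂(κ)₁) holds for all admissible x, y ∈ ℂ and φ ∈ ℂ³. -/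

import Mathlib

noncomputable section

open Complex

/-- `p^w := exp(w · log p)` for a real base `p` and complex exponent `w`. -/
def pPow (p : ℝ) (w : ℂ) : ℂ := Complex.exp (w * (Real.log p : ℂ))

/-- The renormalised Jacobi theta function
`θ(z;p) = ∏_{m=0}^∞ (1 − p^m z)(1 − p^{m+1}/z)`. -/
def theta (p : ℝ) (z : ℂ) : ℂ :=
  ∏' m : ℕ, ((1 - (p : ℂ) ^ m * z) * (1 - (p : ℂ) ^ (m + 1) / z))

/-- `A^y(x)`. -/
def Afun (p : ℝ) (κ y x : ℂ) : ℂ :=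
  (theta p (pPow p (2 * κ)) * theta p (pPow p (y - x)) /
      (theta p (pPow p y) * theta p (pPow p (2 * κ - x)))) *
    pPow p ((2 * κ - y) * x)

/-- `B^y(x)`. -/
def Bfun (p : ℝ) (κ y x : ℂ) : ℂ :=
  (theta p (pPow p (2 * κ - y)) * theta p (pPow p (-x)) /
      (theta p (pPow p (2 * κ - x)) * theta p (pPow p (-y)))) *
    pPow p (2 * κ * (x - y))

/-- The elliptic `c`-function `c(x) = p^{2κx} θ(p^{2κ+x};p)/θ(p^x;p)`. -/
def cfun (p : ℝ) (κ x : ℂ) : ℂ :=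
  pPow p (2 * κ * x) * theta p (pPow p (2 * κ + x)) / theta p (pPow p x)

/-- `(−1)^{p(i)}` for the parity map `p(1)=p(2)=0`, `p(3)=1` (indices `0,1,2` in Lean). -/
def sgn3 (i : Fin 3) : ℂ := if i = 2 then -1 else 1

/-- The matrix of the elliptic dynamical `R`-operator `R(x;φ)` on `V ⊗ V`, `V = ℂ³`,
with respect to the basis `v_i ⊗ v_j` (the pair `(i,j)` indexes the column, i.e. the input):
`R(x;φ)(v_i ⊗ v_i) = (−1)^{p(i)} (c(x)/c((−1)^{p(i)}x)) v_i ⊗ v_i` and, for `i ≠ j`,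
`R(x;φ)(v_i ⊗ v_j) = A^{φ_i−φ_j}(x) v_i ⊗ v_j + (−1)^{p(i)+p(j)} B^{φ_i−φ_j}(x) v_j ⊗ v_i`. -/
def Rop (p : ℝ) (κ x : ℂ) (φ : Fin 3 → ℂ) :
    Matrix (Fin 3 × Fin 3) (Fin 3 × Fin 3) ℂ := fun ab ij =>
  if ij.1 = ij.2 then
    (if ab = ij then sgn3 ij.1 * (cfun p κ x / cfun p κ (sgn3 ij.1 * x)) else 0)
  else
    (if ab = ij then Afun p κ (φ ij.1 - φ ij.2) x else 0) +
      (if ab = (ij.2, ij.1) then sgn3 ij.1 * sgn3 ij.2 * Bfun p κ (φ ij.1 - φ ij.2) x else 0)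

/-- Admissibility of the parameters `(x,φ)` for the operator `R(x;φ)`: every theta-function
factor occurring in a denominator of an entry of `R(x;φ)` is nonzero. -/
def RAdm (p : ℝ) (κ x : ℂ) (φ : Fin 3 → ℂ) : Prop :=
  theta p (pPow p x) ≠ 0 ∧ theta p (pPow p (2 * κ + x)) ≠ 0 ∧
    theta p (pPow p (2 * κ - x)) ≠ 0 ∧
    ∀ i j : Fin 3, i ≠ j → theta p (pPow p (φ i - φ j)) ≠ 0


/-- The weights of the vector representation `V`:
`wt(1) = (1,0,0)`, `wt(2) = (0,1,0)`, `wt(3) = (0,0,−1)` (indices `0,1,2` in Lean). -/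
def wt3 (k : Fin 3) : Fin 3 → ℂ := fun j => if j = k then sgn3 k else 0

/-- For a family `ψ : Fin 3 → (Fin 3 → ℂ)` of dynamical parameters, the operator on
`V ⊗ V ⊗ V` acting on `v_a ⊗ v_b ⊗ v_c` as `(R(x; ψ c)(v_a ⊗ v_b)) ⊗ v_c`. -/
def R12 (p : ℝ) (κ x : ℂ) (ψ : Fin 3 → Fin 3 → ℂ) :
    Matrix (Fin 3 × Fin 3 × Fin 3) (Fin 3 × Fin 3 × Fin 3) ℂ := fun a b =>
  if a.2.2 = b.2.2 then Rop p κ x (ψ b.2.2) (a.1, a.2.1) (b.1, b.2.1) else 0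

/-- For a family `ψ : Fin 3 → (Fin 3 → ℂ)` of dynamical parameters, the operator on
`V ⊗ V ⊗ V` acting on `v_a ⊗ v_b ⊗ v_c` as `v_a ⊗ (R(x; ψ a)(v_b ⊗ v_c))`. -/
def R23 (p : ℝ) (κ x : ℂ) (ψ : Fin 3 → Fin 3 → ℂ) :
    Matrix (Fin 3 × Fin 3 × Fin 3) (Fin 3 × Fin 3 × Fin 3) ℂ := fun a b =>
  if a.1 = b.1 then Rop p κ x (ψ b.1) (a.2.1, a.2.2) (b.2.1, b.2.2) else 0

/-- The shift vectors `Φ^{(j)}(α)`: `Φ^{(1)}(α) = (−α, 0, 0)`, `Φ^{(2)}(α) = (0, −α, 0)`,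
`Φ^{(3)}(α) = (0, 0, α + π√−1 (log p)⁻¹)`. -/
def PhiSh (p : ℝ) (α : ℂ) : Fin 3 → Fin 3 → ℂ := fun k =>
  if k = 0 then ![-α, 0, 0]
  else if k = 1 then ![0, -α, 0]
  else ![0, 0, α + (Real.pi : ℂ) * Complex.I * (Real.log p : ℂ)⁻¹]

/-- The shift vectors `Ξ^{(j)}(α)`: `Ξ^{(1)}(α) = (−α, 0, 0)`, `Ξ^{(2)}(α) = (0, −α, 0)`,
`Ξ^{(3)}(α) = (0, 0, α)`. -/
def XiSh (α : ℂ) : Fin 3 → Fin 3 → ℂ := fun k =>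
  if k = 0 then ![-α, 0, 0]
  else if k = 1 then ![0, -α, 0]
  else ![0, 0, α]

lemma pPow_ne_zero (p : ℝ) (w : ℂ) : pPow p w ≠ 0 := Complex.exp_ne_zero _

@[fun_prop]
lemma differentiable_pPow (p : ℝ) : Differentiable ℂ (pPow p) := by
  unfold pPow
  fun_prop

lemma differentiableOn_theta {p : ℝ} (hp0 : 0 < p) (hp1 : p < 1) :
    DifferentiableOn ℂ (theta p) {0}ᶜ := by
  intro z₀ hz₀
  have hz₀ : z₀ ≠ 0 := hz₀
  set K : Set ℂ := {z | ‖z‖ < ‖z₀‖ + 1 ∧ ‖z₀‖ / 2 < ‖z‖} with hK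
  have hpos : 0 < ‖z₀‖ := norm_pos_iff.2 hz₀
  have hopen : IsOpen K :=
    (isOpen_lt continuous_norm continuous_const).and (isOpen_lt continuous_const continuous_norm)
  have hne : ∀ z ∈ K, z ≠ 0 := fun z hz => norm_pos_iff.1 ((half_pos hpos).trans hz.2)
  set f : ℕ → ℂ → ℂ := fun m z =>
    (1 - (p : ℂ) ^ m * z) * (1 - (p : ℂ) ^ (m + 1) / z) - 1 with hf
  have hdiff : ∀ m, DifferentiableOn ℂ (f m) K := fun m =>
    (((differentiableOn_id.const_mul _).const_sub 1).mul
      (((differentiableOn_const _).div differentiableOn_id hne).const_sub 1)).sub_const 1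
  have hbound : ∀ m, ∀ z ∈ K, ‖f m z‖ ≤ p ^ m * ((‖z₀‖ + 1) + 2 / ‖z₀‖ + 1) := by
    intro m z hz
    have hz0 := hne z hz
    have hfz : f m z = (p : ℂ) ^ m * (-z - p * z⁻¹ + (p : ℂ) ^ (m + 1)) := by
      simp only [hf]
      field_simp
      ring
    have hinv : ‖z‖⁻¹ ≤ 2 / ‖z₀‖ := by
      rw [← inv_div]
      exact inv_anti₀ (half_pos hpos) hz.2.le
    have hpn : ‖(p : ℂ)‖ = p := by simp [abs_of_pos hp0]
    rw [hfz, norm_mul, norm_pow, hpn]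
    gcongr
    refine (norm_add_le _ _).trans (add_le_add ((norm_sub_le _ _).trans (add_le_add ?_ ?_)) ?_)
    · simpa using hz.1.le
    · rw [norm_mul, norm_inv, hpn]
      calc p * ‖z‖⁻¹ ≤ 1 * ‖z‖⁻¹ := by gcongr
        _ ≤ _ := by simpa using hinv
    · rw [norm_pow, hpn]
      exact pow_le_one₀ hp0.le hp1.le
  have hsum : Summable fun m : ℕ => p ^ m * ((‖z₀‖ + 1) + 2 / ‖z₀‖ + 1) :=
    (summable_geometric_of_lt_one hp0.le hp1).mul_right _
  have hprod := hsum.hasProdLocallyUniformlyOn_nat_one_add hopen (.of_forall hbound)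
    fun m => (hdiff m).continuousOn
  have hth : (fun z => ∏' m, (1 + f m z)) = theta p := by
    funext z
    simp [theta, hf]
  rw [hth] at hprod
  have hd : DifferentiableOn ℂ (theta p) K :=
    hprod.differentiableOn (.of_forall fun s => by
      simpa [Finset.prod_fn] using
        DifferentiableOn.finsetProd fun m _ => (hdiff m).const_add 1) hopen
  exact (hd.differentiableAt (hopen.mem_nhds ⟨by linarith, by linarith⟩)).differentiableWithinAt

lemma differentiable_theta_pPow {p : ℝ} (hp0 : 0 < p) (hp1 : p < 1) :
    Differentiable ℂ fun w => theta p (pPow p w) := fun w =>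
  ((differentiableOn_theta hp0 hp1).differentiableAt
    (isOpen_compl_singleton.mem_nhds (pPow_ne_zero p w))).comp w (differentiable_pPow p w)

lemma eventually_theta_pPow_ne_zero {p : ℝ} (hp0 : 0 < p) (hp1 : p < 1) {x : ℂ}
    (hx : theta p (pPow p x) ≠ 0) (w : ℂ) :
    ∀ᶠ u in nhdsWithin w {w}ᶜ, theta p (pPow p u) ≠ 0 := by
  have han : AnalyticOnNhd ℂ (fun w => theta p (pPow p w)) Set.univ :=
    fun w _ => (differentiable_theta_pPow hp0 hp1).analyticAt w
  rcases (han w trivial).eventually_eq_zero_or_eventually_ne_zero with h | h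
  · exact absurd (han.eqOn_zero_of_preconnected_of_eventuallyEq_zero isPreconnected_univ
      trivial h (Set.mem_univ x)) hx
  · exact h

/-- Translating the dynamical parameter `φ` in a direction with distinct coordinates preserves
the admissibility conditions on `x` and makes those on `φ` hold generically. -/
lemma eventually_RAdm {p : ℝ} (hp0 : 0 < p) (hp1 : p < 1) {κ x : ℂ} {φ : Fin 3 → ℂ}
    (h : RAdm p κ x φ) (ψ : Fin 3 → ℂ) :
    ∀ᶠ t in nhdsWithin (0 : ℂ) {0}ᶜ, RAdm p κ x fun j => ψ j + t * (j : ℕ) := by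
  have hij : ∀ i j : Fin 3, i ≠ j → ∀ᶠ t in nhdsWithin (0 : ℂ) {0}ᶜ,
      theta p (pPow p ((ψ i + t * (i : ℕ)) - (ψ j + t * (j : ℕ)))) ≠ 0 := by
    intro i j hne
    have hc : ((i : ℕ) : ℂ) - ((j : ℕ) : ℂ) ≠ 0 :=
      sub_ne_zero.2 fun hc => hne (Fin.ext (Nat.cast_injective hc))
    have ht : Filter.Tendsto (fun t : ℂ => (ψ i + t * (i : ℕ)) - (ψ j + t * (j : ℕ)))
        (nhdsWithin 0 {0}ᶜ) (nhdsWithin (ψ i - ψ j) {ψ i - ψ j}ᶜ) := by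
      refine tendsto_nhdsWithin_iff.2 ⟨?_, ?_⟩
      · refine Filter.Tendsto.mono_left ?_ nhdsWithin_le_nhds
        have : Continuous fun t : ℂ => (ψ i + t * (i : ℕ)) - (ψ j + t * (j : ℕ)) := by fun_prop
        simpa using this.tendsto 0
      · filter_upwards [self_mem_nhdsWithin] with t ht0 heq
        have : t * (((i : ℕ) : ℂ) - ((j : ℕ) : ℂ)) = 0 := by
          linear_combination (Set.mem_singleton_iff.1 heq)
        exact (mul_ne_zero ht0 hc) this
    exact ht.eventually (eventually_theta_pPow_ne_zero hp0 hp1 h.1 _)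
  have hall : ∀ᶠ t in nhdsWithin (0 : ℂ) {0}ᶜ, ∀ i j : Fin 3, i ≠ j →
      theta p (pPow p ((ψ i + t * (i : ℕ)) - (ψ j + t * (j : ℕ)))) ≠ 0 := by
    simpa only [Filter.eventually_all] using hij
  filter_upwards [hall] with t ht
  exact ⟨h.1, h.2.1, h.2.2.1, ht⟩

lemma continuousAt_Afun {p : ℝ} (hp0 : 0 < p) (hp1 : p < 1) {κ y x : ℂ}
    (hy : theta p (pPow p y) ≠ 0) (hx : theta p (pPow p (2 * κ - x)) ≠ 0) :
    ContinuousAt (fun y => Afun p κ y x) y := by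
  have hth := (differentiable_theta_pPow hp0 hp1).continuous
  have h1 : Continuous fun y => theta p (pPow p (y - x)) :=
    hth.comp (continuous_id.sub continuous_const)
  have h2 : Continuous fun y => pPow p ((2 * κ - y) * x) :=
    (differentiable_pPow p).continuous.comp (by fun_prop)
  unfold Afun
  exact ((continuousAt_const.mul h1.continuousAt).div
    (hth.continuousAt.mul continuousAt_const) (mul_ne_zero hy hx)).mul h2.continuousAt

lemma continuousAt_Bfun {p : ℝ} (hp0 : 0 < p) (hp1 : p < 1) {κ y x : ℂ}
    (hy : theta p (pPow p (-y)) ≠ 0) (hx : theta p (pPow p (2 * κ - x)) ≠ 0) :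
    ContinuousAt (fun y => Bfun p κ y x) y := by
  have hth := (differentiable_theta_pPow hp0 hp1).continuous
  have h1 : Continuous fun y => theta p (pPow p (2 * κ - y)) :=
    hth.comp (continuous_const.sub continuous_id)
  have h2 : Continuous fun y => pPow p (2 * κ * (x - y)) :=
    (differentiable_pPow p).continuous.comp (by fun_prop)
  have h3 : Continuous fun y => theta p (pPow p (-y)) := hth.comp continuous_neg
  unfold Bfun
  exact ((h1.continuousAt.mul continuousAt_const).div
    (continuousAt_const.mul h3.continuousAt) (mul_ne_zero hx hy)).mul h2.continuousAt

lemma continuousAt_Rop {p : ℝ} (hp0 : 0 < p) (hp1 : p < 1) {κ x : ℂ} {φ : ℂ → Fin 3 → ℂ}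
    {t : ℂ} (hφ : Continuous φ) (h : RAdm p κ x (φ t)) (a b : Fin 3 × Fin 3) :
    ContinuousAt (fun t => Rop p κ x (φ t) a b) t := by
  unfold Rop
  by_cases hb : b.1 = b.2
  · simpa only [if_pos hb] using continuousAt_const
  · simp only [if_neg hb]
    have hsub : Continuous fun t => φ t b.1 - φ t b.2 := by fun_prop
    have hA : ContinuousAt (fun t => Afun p κ (φ t b.1 - φ t b.2) x) t :=
      ContinuousAt.comp (g := fun y => Afun p κ y x) (continuousAt_Afun hp0 hp1
        (h.2.2.2 _ _ hb) h.2.2.1) hsub.continuousAt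
    have hB : ContinuousAt (fun t => Bfun p κ (φ t b.1 - φ t b.2) x) t :=
      ContinuousAt.comp (g := fun y => Bfun p κ y x) (continuousAt_Bfun hp0 hp1
        (by simpa using h.2.2.2 _ _ (Ne.symm hb)) h.2.2.1) hsub.continuousAt
    refine ContinuousAt.add ?_ ?_
    · split_ifs
      exacts [hA, continuousAt_const]
    · split_ifs
      exacts [continuousAt_const.mul hB, continuousAt_const]

lemma continuousAt_R12 {p : ℝ} (hp0 : 0 < p) (hp1 : p < 1) {κ x : ℂ}
    {ψ : ℂ → Fin 3 → Fin 3 → ℂ} {t : ℂ} (hψ : Continuous ψ) (h : ∀ k, RAdm p κ x (ψ t k)) :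
    ContinuousAt (fun t => R12 p κ x (ψ t)) t := by
  refine continuousAt_pi.2 fun a => continuousAt_pi.2 fun b => ?_
  unfold R12
  split_ifs
  · exact continuousAt_Rop hp0 hp1 ((continuous_apply b.2.2).comp hψ) (h _) _ _
  · exact continuousAt_const

lemma continuousAt_R23 {p : ℝ} (hp0 : 0 < p) (hp1 : p < 1) {κ x : ℂ}
    {ψ : ℂ → Fin 3 → Fin 3 → ℂ} {t : ℂ} (hψ : Continuous ψ) (h : ∀ k, RAdm p κ x (ψ t k)) :
    ContinuousAt (fun t => R23 p κ x (ψ t)) t := by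
  refine continuousAt_pi.2 fun a => continuousAt_pi.2 fun b => ?_
  unfold R23
  split_ifs
  · exact continuousAt_Rop hp0 hp1 ((continuous_apply b.1).comp hψ) (h _) _ _
  · exact continuousAt_const

/-- `M` and `N` agree on the coordinate subspace spanned by `S`, and map it to itself. -/
def AgreeOn {ι : Type*} (S : Set ι) (M N : Matrix ι ι ℂ) : Prop :=
  ∀ b ∈ S, ∀ a, M a b = N a b ∧ (a ∉ S → M a b = 0)

lemma AgreeOn.mul {ι : Type*} [Fintype ι] {S : Set ι} {M N M' N' : Matrix ι ι ℂ}
    (h : AgreeOn S M N) (h' : AgreeOn S M' N') : AgreeOn S (M * M') (N * N') := by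
  intro b hb a
  simp only [Matrix.mul_apply]
  refine ⟨Finset.sum_congr rfl fun c _ => ?_, fun ha => Finset.sum_eq_zero fun c _ => ?_⟩
  · by_cases hc : c ∈ S
    · rw [(h c hc a).1, (h' b hb c).1]
    · rw [← (h' b hb c).1, (h' b hb c).2 hc, mul_zero, mul_zero]
  · by_cases hc : c ∈ S
    · rw [(h c hc a).2 ha, zero_mul]
    · rw [(h' b hb c).2 hc, mul_zero]

/-- The number of odd tensor factors of `v_a ⊗ v_b ⊗ v_c`. -/
def oddCount (a : Fin 3 × Fin 3 × Fin 3) : ℕ :=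
  (if a.1 = 2 then 1 else 0) + (if a.2.1 = 2 then 1 else 0) + (if a.2.2 = 2 then 1 else 0)

lemma Rop_congr {p : ℝ} {κ x : ℂ} {φ φ' : Fin 3 → ℂ} {b : Fin 3 × Fin 3}
    (h : b.1 ≠ b.2 → φ b.1 - φ b.2 = φ' b.1 - φ' b.2) (a : Fin 3 × Fin 3) :
    Rop p κ x φ a b = Rop p κ x φ' a b := by
  unfold Rop
  split_ifs <;> simp_all

lemma Rop_eq_zero {p : ℝ} {κ x : ℂ} {φ : Fin 3 → ℂ} {a b : Fin 3 × Fin 3}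
    (h : a ≠ b) (h' : a ≠ b.swap) : Rop p κ x φ a b = 0 := by
  have h' : a ≠ (b.2, b.1) := h'
  simp [Rop, h, h']

/-- Two families of dynamical parameters that cannot be told apart by the operators `R₁₂`, `R₂₃`
on the span of the basis vectors with `n` odd tensor factors. -/
def IndistinctOn (n : ℕ) (ψ ψ' : Fin 3 → Fin 3 → ℂ) : Prop :=
  ∀ k i j, oddCount (k, i, j) = n → i ≠ j → ψ k i - ψ k j = ψ' k i - ψ' k j

lemma IndistinctOn.R12 {n : ℕ} {ψ ψ' : Fin 3 → Fin 3 → ℂ} (h : IndistinctOn n ψ ψ')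
    (p : ℝ) (κ x : ℂ) :
    AgreeOn {b | oddCount b = n} (R12 p κ x ψ) (R12 p κ x ψ') := by
  rintro ⟨i, j, k⟩ hb ⟨a₁, a₂, a₃⟩
  simp only [_root_.R12, Set.mem_ofPred_eq] at hb ⊢
  split_ifs with hk
  · refine ⟨Rop_congr (h k i j ?_) _, fun ha => Rop_eq_zero ?_ ?_⟩
    · rw [← hb]
      simp only [oddCount]
      ring
    · rintro ⟨⟩
      exact ha (hk ▸ hb)
    · rintro ⟨⟩
      refine ha ?_
      rw [← hb, hk]
      simp only [oddCount]
      ring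
  · simp

lemma IndistinctOn.R23 {n : ℕ} {ψ ψ' : Fin 3 → Fin 3 → ℂ} (h : IndistinctOn n ψ ψ')
    (p : ℝ) (κ x : ℂ) :
    AgreeOn {b | oddCount b = n} (R23 p κ x ψ) (R23 p κ x ψ') := by
  rintro ⟨k, i, j⟩ hb ⟨a₁, a₂, a₃⟩
  simp only [_root_.R23, Set.mem_ofPred_eq] at hb ⊢
  split_ifs with hk
  · refine ⟨Rop_congr (h k i j hb) _, fun ha => Rop_eq_zero ?_ ?_⟩
    · rintro ⟨⟩
      exact ha (hk ▸ hb)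
    · rintro ⟨⟩
      refine ha ?_
      rw [← hb, hk]
      simp only [oddCount]
      ring
  · simp

/-- The Yang–Baxter identity at `x`, `y` for given families of dynamical parameters. -/
def YBAt (p : ℝ) (κ x y : ℂ) (ψ ψ' : Fin 3 → Fin 3 → ℂ) : Prop :=
  R12 p κ x ψ * R23 p κ (x + y) ψ' * R12 p κ y ψ =
    R23 p κ y ψ' * R12 p κ (x + y) ψ * R23 p κ x ψ'

/-- Admissibility of `x`, `y`, `φ` for the Yang–Baxter identity with shift family `σ`. -/
def YBAdm (p : ℝ) (κ : ℂ) (σ : ℂ → Fin 3 → Fin 3 → ℂ) (x y : ℂ) (φ : Fin 3 → ℂ) : Prop :=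
  ∀ k : Fin 3, ∀ z ∈ ({x, y, x + y} : Set ℂ),
    RAdm p κ z (fun j => φ j + σ (-κ) k j) ∧ RAdm p κ z (fun j => φ j + σ κ k j)

/-- The shifted Yang–Baxter identity with shift family `σ`, for all admissible parameters. -/
def ShiftedYB (p : ℝ) (κ : ℂ) (σ : ℂ → Fin 3 → Fin 3 → ℂ) : Prop :=
  ∀ (x y : ℂ) (φ : Fin 3 → ℂ), YBAdm p κ σ x y φ →
    YBAt p κ x y (fun k j => φ j + σ (-κ) k j) (fun k j => φ j + σ κ k j)

/-- On each sector, the shift families `σ` and `σ'` differ by a fixed translation of `φ`. -/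
def SectorwiseTranslate (σ σ' : ℂ → Fin 3 → Fin 3 → ℂ) : Prop :=
  ∀ n, ∃ d : Fin 3 → ℂ, ∀ α, IndistinctOn n (fun k j => d j + σ α k j) (σ' α)

lemma YBAdm.eventually {p : ℝ} (hp0 : 0 < p) (hp1 : p < 1) {κ x y : ℂ}
    {σ' : ℂ → Fin 3 → Fin 3 → ℂ} {φ : Fin 3 → ℂ} (h : YBAdm p κ σ' x y φ)
    (σ : ℂ → Fin 3 → Fin 3 → ℂ) (φ' : Fin 3 → ℂ) :
    ∀ᶠ t in nhdsWithin (0 : ℂ) {0}ᶜ, YBAdm p κ σ x y fun j => φ' j + t * (j : ℕ) := by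
  have hfin : ({x, y, x + y} : Set ℂ).Finite := Set.toFinite _
  refine Filter.eventually_all.2 fun k => (Filter.eventually_all_finite hfin).2 fun z hz => ?_
  have key := fun α => eventually_RAdm hp0 hp1 (h k z hz).1 fun j => φ' j + σ α k j
  filter_upwards [key (-κ), key κ] with t h₁ h₂
  simp only [add_right_comm (φ' _) (t * _)]
  exact ⟨h₁, h₂⟩

/-- If every sector of the identity for `σ'` is a translate of the one for `σ`, then the latter
implies the former; parameters that are not admissible for `σ` are reached by continuity. -/
lemma ShiftedYB.of_sectorwiseTranslate {p : ℝ} (hp0 : 0 < p) (hp1 : p < 1) {κ : ℂ}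
    {σ σ' : ℂ → Fin 3 → Fin 3 → ℂ} (hσ : SectorwiseTranslate σ σ') (h : ShiftedYB p κ σ) :
    ShiftedYB p κ σ' := by
  intro x y φ hadm
  have hgen : ∀ n, ∀ᶠ t in nhdsWithin (0 : ℂ) {0}ᶜ, ∀ a b, oddCount b = n →
      (R12 p κ x (fun k j => φ j + t * (j : ℕ) + σ' (-κ) k j) *
        R23 p κ (x + y) (fun k j => φ j + t * (j : ℕ) + σ' κ k j) *
        R12 p κ y (fun k j => φ j + t * (j : ℕ) + σ' (-κ) k j)) a b =
      (R23 p κ y (fun k j => φ j + t * (j : ℕ) + σ' κ k j) *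
        R12 p κ (x + y) (fun k j => φ j + t * (j : ℕ) + σ' (-κ) k j) *
        R23 p κ x (fun k j => φ j + t * (j : ℕ) + σ' κ k j)) a b := by
    intro n
    obtain ⟨d, hd⟩ := hσ n
    filter_upwards [hadm.eventually hp0 hp1 σ fun j => φ j + d j] with t ht a b hb
    have hyb := h x y _ ht
    have hI : ∀ α, IndistinctOn n (fun k j => φ j + d j + t * (j : ℕ) + σ α k j)
        (fun k j => φ j + t * (j : ℕ) + σ' α k j) := fun α k i j hn hij => by
      linear_combination hd α k i j hn hij
    rw [← ((((hI (-κ)).R12 p κ x).mul ((hI κ).R23 p κ (x + y))).mul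
        ((hI (-κ)).R12 p κ y) b hb a).1,
      ← ((((hI κ).R23 p κ y).mul ((hI (-κ)).R12 p κ (x + y))).mul
        ((hI κ).R23 p κ x) b hb a).1]
    exact congrFun (congrFun hyb a) b
  have hψ : ∀ α, Continuous fun (t : ℂ) (k j : Fin 3) => φ j + t * (j : ℕ) + σ' α k j :=
    fun α => by fun_prop
  have hcont₁₂ : ∀ z ∈ ({x, y, x + y} : Set ℂ), ContinuousAt
      (fun t : ℂ => R12 p κ z fun k j => φ j + t * (j : ℕ) + σ' (-κ) k j) 0 := fun z hz =>
    continuousAt_R12 hp0 hp1 (hψ _) fun k => by simpa using (hadm k z hz).1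
  have hcont₂₃ : ∀ z ∈ ({x, y, x + y} : Set ℂ), ContinuousAt
      (fun t : ℂ => R23 p κ z fun k j => φ j + t * (j : ℕ) + σ' κ k j) 0 := fun z hz =>
    continuousAt_R23 hp0 hp1 (hψ _) fun k => by simpa using (hadm k z hz).2
  have hl := ((hcont₁₂ x (by simp)).mul (hcont₂₃ (x + y) (by simp))).mul (hcont₁₂ y (by simp))
  have hr := ((hcont₂₃ y (by simp)).mul (hcont₁₂ (x + y) (by simp))).mul (hcont₂₃ x (by simp))
  have heq := tendsto_nhds_unique_of_eventuallyEq
    (hl.tendsto.mono_left nhdsWithin_le_nhds) (hr.tendsto.mono_left nhdsWithin_le_nhds) (by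
      have hall : ∀ᶠ t in nhdsWithin (0 : ℂ) {0}ᶜ, ∀ n ∈ Set.range oddCount, _ :=
        (Filter.eventually_all_finite (Set.finite_range oddCount)).2 fun n _ => hgen n
      filter_upwards [hall] with t ht
      ext a b
      exact ht _ ⟨b, rfl⟩ a b rfl)
  simpa [YBAt] using heq

lemma SectorwiseTranslate.symm {σ σ' : ℂ → Fin 3 → Fin 3 → ℂ} (h : SectorwiseTranslate σ σ') :
    SectorwiseTranslate σ' σ := fun n => by
  obtain ⟨d, hd⟩ := h n
  refine ⟨fun j => -d j, fun α k i j hn hij => ?_⟩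
  linear_combination -hd α k i j hn hij

lemma sectorwiseTranslate_PhiSh_XiSh (p : ℝ) : SectorwiseTranslate (PhiSh p) XiSh := by
  intro n
  set η : ℂ := (Real.pi : ℂ) * Complex.I * (Real.log p : ℂ)⁻¹ with hη
  refine ⟨if n = 2 then ![0, 0, -η] else 0, fun α k i j hn hij => ?_⟩
  subst hn
  fin_cases k <;> fin_cases i <;> fin_cases j <;>
    simp [oddCount, PhiSh, XiSh, ← hη] at hij ⊢

/-- **The `π√−1(log p)⁻¹` term in the third shift vector may be omitted**: the shifted
Yang–Baxter identity with shift vectors `Φ` holds for all admissible `x, y, φ` if and only if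
the identity with shift vectors `Ξ` holds for all admissible `x, y, φ`. -/
theorem shifted_qYB_Phi_iff_Xi (p : ℝ) (hp0 : 0 < p) (hp1 : p < 1) (κ : ℂ) :
    (∀ (x y : ℂ) (φ : Fin 3 → ℂ),
      (∀ k : Fin 3, ∀ z ∈ ({x, y, x + y} : Set ℂ),
        RAdm p κ z (fun j => φ j + PhiSh p (-κ) k j) ∧
          RAdm p κ z (fun j => φ j + PhiSh p κ k j)) →
      R12 p κ x (fun k j => φ j + PhiSh p (-κ) k j) *
          R23 p κ (x + y) (fun k j => φ j + PhiSh p κ k j) *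
          R12 p κ y (fun k j => φ j + PhiSh p (-κ) k j) =
        R23 p κ y (fun k j => φ j + PhiSh p κ k j) *
          R12 p κ (x + y) (fun k j => φ j + PhiSh p (-κ) k j) *
          R23 p κ x (fun k j => φ j + PhiSh p κ k j)) ↔
    (∀ (x y : ℂ) (φ : Fin 3 → ℂ),
      (∀ k : Fin 3, ∀ z ∈ ({x, y, x + y} : Set ℂ),
        RAdm p κ z (fun j => φ j + XiSh (-κ) k j) ∧
          RAdm p κ z (fun j => φ j + XiSh κ k j)) →
      R12 p κ x (fun k j => φ j + XiSh (-κ) k j) *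
          R23 p κ (x + y) (fun k j => φ j + XiSh κ k j) *
          R12 p κ y (fun k j => φ j + XiSh (-κ) k j) =
        R23 p κ y (fun k j => φ j + XiSh κ k j) *
          R12 p κ (x + y) (fun k j => φ j + XiSh (-κ) k j) *
          R23 p κ x (fun k j => φ j + XiSh κ k j)) := by
  exact ⟨ShiftedYB.of_sectorwiseTranslate hp0 hp1 (sectorwiseTranslate_PhiSh_XiSh p),
    ShiftedYB.of_sectorwiseTranslate hp0 hp1 (sectorwiseTranslate_PhiSh_XiSh p).symm⟩

end
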